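/- arXiv:2009.10867 — 2 statements merged into one kernel-verified Lean document; each statement's English description precedes it below -/
import Mathlib

section
/- For every w ∈ EuclideanSpace ℝ (Fin d), setting a* = ⟨w, x̄⁺⟩, b* = ⟨w, x̄⁻⟩, and α* = b* - a*, one has Σ_{t=1}^{T} f_t(w, a*, b*, α*) = (T₊·T₋/T)·(F(w) - 1); that is, substituting the optimal auxiliary values a(w), b(w), α(w) into the saddle-point objective recovers the pairwise least-squares AUC objective up to the positive factor T₊T₋/T and an additive constant. -/
open scoped RealInnerProductSpace
open Finset

/-- Number of positively labeled samples. -/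
def numPos (T : ℕ) (y : Fin T → ℤ) : ℕ := (Finset.univ.filter fun t => y t = 1).card

/-- Number of negatively labeled samples. -/
def numNeg (T : ℕ) (y : Fin T → ℤ) : ℕ := (Finset.univ.filter fun t => y t = -1).card

/-- The mean of the positively labeled samples. -/
noncomputable def meanPos (d T : ℕ) (x : Fin T → EuclideanSpace ℝ (Fin d))
    (y : Fin T → ℤ) : EuclideanSpace ℝ (Fin d) :=
  ((numPos T y : ℝ))⁻¹ • ∑ t ∈ Finset.univ.filter fun t => y t = 1, x t

/-- The mean of the negatively labeled samples. -/
noncomputable def meanNeg (d T : ℕ) (x : Fin T → EuclideanSpace ℝ (Fin d))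
    (y : Fin T → ℤ) : EuclideanSpace ℝ (Fin d) :=
  ((numNeg T y : ℝ))⁻¹ • ∑ t ∈ Finset.univ.filter fun t => y t = -1, x t

/-- The per-sample loss `f_t(w, a, b, α)` of the empirical saddle-point reformulation,
where `p = T₊ / T`. -/
noncomputable def fsad (d T : ℕ) (x : Fin T → EuclideanSpace ℝ (Fin d)) (y : Fin T → ℤ)
    (w : EuclideanSpace ℝ (Fin d)) (a b α : ℝ) (t : Fin T) : ℝ :=
  let p : ℝ := (numPos T y : ℝ) / (T : ℝ)
  (1 - p) * (⟪w, x t⟫ - a) ^ 2 * (if y t = 1 then (1 : ℝ) else 0)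
    + p * (⟪w, x t⟫ - b) ^ 2 * (if y t = -1 then (1 : ℝ) else 0)
    - p * (1 - p) * α ^ 2
    + 2 * (1 + α) * ⟪w, x t⟫ *
        (p * (if y t = -1 then (1 : ℝ) else 0) - (1 - p) * (if y t = 1 then (1 : ℝ) else 0))

/-- The pairwise least-squares AUC surrogate objective. -/
noncomputable def lsAUC (d T : ℕ) (x : Fin T → EuclideanSpace ℝ (Fin d))
    (y : Fin T → ℤ) (w : EuclideanSpace ℝ (Fin d)) : ℝ :=
  (1 / ((numPos T y : ℝ) * (numNeg T y : ℝ))) *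
    ∑ s ∈ Finset.univ.filter fun s => y s = 1,
      ∑ t ∈ Finset.univ.filter fun t => y t = -1, (1 - ⟪w, x s - x t⟫) ^ 2

/-- Every label is `1` or `-1`, so the two class sizes add up to the sample size. -/
theorem numPos_add_numNeg (T : ℕ) (y : Fin T → ℤ) (hy : ∀ t, y t = 1 ∨ y t = -1) :
    numPos T y + numNeg T y = T := by
  have hneg : (univ.filter fun t => y t = -1) = univ.filter fun t => ¬ y t = 1 := by
    ext t
    have := hy t
    simp only [mem_filter, mem_univ, true_and]
    lia
  rw [numPos, numNeg, hneg, card_filter_add_card_filter_not, card_univ, Fintype.card_fin]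

theorem sum_sub_const_sq {ι : Type*} (s : Finset ι) (u : ι → ℝ) (c : ℝ) :
    ∑ i ∈ s, (u i - c) ^ 2 = ∑ i ∈ s, u i ^ 2 - 2 * c * ∑ i ∈ s, u i + s.card * c ^ 2 := by
  simp only [sub_sq, sum_add_distrib, sum_sub_distrib, sum_const, nsmul_eq_mul, mul_sum]
  congr 2
  exact sum_congr rfl fun i _ => by ring

theorem sum_sum_one_sub_sub_sq {ι : Type*} (P N : Finset ι) (u : ι → ℝ) :
    ∑ i ∈ P, ∑ j ∈ N, (1 - (u i - u j)) ^ 2 =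
      P.card * N.card + N.card * ∑ i ∈ P, u i ^ 2 + P.card * ∑ j ∈ N, u j ^ 2
        - 2 * N.card * ∑ i ∈ P, u i + 2 * P.card * ∑ j ∈ N, u j
        - 2 * (∑ i ∈ P, u i) * ∑ j ∈ N, u j := by
  have inner_sum (i : ι) : ∑ j ∈ N, (1 - (u i - u j)) ^ 2 =
      ∑ j ∈ N, u j ^ 2 - 2 * (u i - 1) * ∑ j ∈ N, u j + N.card * (u i - 1) ^ 2 := by
    rw [← sum_sub_const_sq]
    exact sum_congr rfl fun j _ => by ring
  simp only [inner_sum, sum_add_distrib, sum_sub_distrib, ← sum_mul, ← mul_sum,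
    sum_sub_const_sq, sum_const, nsmul_eq_mul]
  ring

/-- The saddle-point objective, split by class. -/
theorem sum_fsad (d T : ℕ) (x : Fin T → EuclideanSpace ℝ (Fin d)) (y : Fin T → ℤ)
    (w : EuclideanSpace ℝ (Fin d)) (a b α p : ℝ) (hp : p = (numPos T y : ℝ) / (T : ℝ)) :
    ∑ t, fsad d T x y w a b α t =
      (1 - p) * ∑ t ∈ univ.filter (fun t => y t = 1), (⟪w, x t⟫ - a) ^ 2
        + p * ∑ t ∈ univ.filter (fun t => y t = -1), (⟪w, x t⟫ - b) ^ 2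
        - T * (p * (1 - p) * α ^ 2)
        + 2 * (1 + α) * (p * ∑ t ∈ univ.filter (fun t => y t = -1), ⟪w, x t⟫
          - (1 - p) * ∑ t ∈ univ.filter (fun t => y t = 1), ⟪w, x t⟫) := by
  have hT : (T : ℝ) * (p * (1 - p) * α ^ 2) = ∑ _t : Fin T, p * (1 - p) * α ^ 2 := by simp
  rw [hT]
  simp only [sum_filter, mul_sum, ← sum_sub_distrib, ← sum_add_distrib]
  refine sum_congr rfl fun t _ => ?_
  simp only [fsad, ← hp]
  split_ifs <;> ring

/-- Substituting the optimal auxiliary values `a(w) = ⟨w, x̄⁺⟩`, `b(w) = ⟨w, x̄⁻⟩`,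
`α(w) = b(w) - a(w)` into the saddle-point objective recovers the pairwise
least-squares AUC objective up to the positive factor `T₊T₋/T` and an additive
constant. -/
theorem sum_fsad_at_optimal_aux (d T : ℕ) (hd : 1 ≤ d) (hT : 1 ≤ T)
    (x : Fin T → EuclideanSpace ℝ (Fin d)) (y : Fin T → ℤ)
    (hy : ∀ t, y t = 1 ∨ y t = -1)
    (hTp : 1 ≤ numPos T y) (hTn : 1 ≤ numNeg T y)
    (w : EuclideanSpace ℝ (Fin d)) :
    ∑ t, fsad d T x y w ⟪w, meanPos d T x y⟫ ⟪w, meanNeg d T x y⟫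
        (⟪w, meanNeg d T x y⟫ - ⟪w, meanPos d T x y⟫) t
      = ((numPos T y : ℝ) * (numNeg T y : ℝ) / (T : ℝ)) * (lsAUC d T x y w - 1) := by
  have hT_eq : (T : ℝ) = numPos T y + numNeg T y := by
    exact_mod_cast (numPos_add_numNeg T y hy).symm
  have hp_pos : (0 : ℝ) < numPos T y := by exact_mod_cast hTp
  have hn_pos : (0 : ℝ) < numNeg T y := by exact_mod_cast hTn
  have hsum_pos : (numPos T y : ℝ) + numNeg T y ≠ 0 := by positivity
  rw [sum_fsad d T x y w _ _ _ _ rfl, lsAUC]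
  simp only [meanPos, meanNeg, inner_smul_right, inner_sum, inner_sub_right,
    sum_sub_const_sq, sum_sum_one_sub_sub_sq _ _ fun t => ⟪w, x t⟫]
  rw [← numPos, ← numNeg, hT_eq]
  field_simp
  ring
end

section
/- For every w ∈ EuclideanSpace ℝ (Fin d), the point (a*, b*, α*) with a* = ⟨w, x̄⁺⟩, b* = ⟨w, x̄⁻⟩, α* = b* - a* is a saddle point of (a,b,α) ↦ Σ_{t=1}^{T} f_t(w, a, b, α): for every α ∈ ℝ, Σ_t f_t(w, a*, b*, α) ≤ Σ_t f_t(w, a*, b*, α*), and for all a, b ∈ ℝ, Σ_t f_t(w, a*, b*, α*) ≤ Σ_t f_t(w, a, b, α*). -/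
open scoped RealInnerProductSpace
open Finset

theorem sum_inner_pos_eq (d T : ℕ) (x : Fin T → EuclideanSpace ℝ (Fin d)) (y : Fin T → ℤ)
    (hTp : 1 ≤ numPos T y) (w : EuclideanSpace ℝ (Fin d)) :
    ∑ t, ⟪w, x t⟫ * (if y t = 1 then (1 : ℝ) else 0) = numPos T y * ⟪w, meanPos d T x y⟫ := by
  have h : (numPos T y : ℝ) ≠ 0 := by positivity
  simp only [mul_ite, mul_one, mul_zero, ← Finset.sum_filter]
  rw [meanPos, inner_smul_right, inner_sum, mul_inv_cancel_left₀ h]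

theorem sum_inner_neg_eq (d T : ℕ) (x : Fin T → EuclideanSpace ℝ (Fin d)) (y : Fin T → ℤ)
    (hTn : 1 ≤ numNeg T y) (w : EuclideanSpace ℝ (Fin d)) :
    ∑ t, ⟪w, x t⟫ * (if y t = -1 then (1 : ℝ) else 0) = numNeg T y * ⟪w, meanNeg d T x y⟫ := by
  have h : (numNeg T y : ℝ) ≠ 0 := by positivity
  simp only [mul_ite, mul_one, mul_zero, ← Finset.sum_filter]
  rw [meanNeg, inner_smul_right, inner_sum, mul_inv_cancel_left₀ h]

/-- The summed loss as an explicit quadratic in `(a, b, α)`. -/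
theorem sum_fsad_eq (d T : ℕ) (hT : 1 ≤ T)
    (x : Fin T → EuclideanSpace ℝ (Fin d)) (y : Fin T → ℤ)
    (hy : ∀ t, y t = 1 ∨ y t = -1)
    (hTp : 1 ≤ numPos T y) (hTn : 1 ≤ numNeg T y)
    (w : EuclideanSpace ℝ (Fin d)) (a b α : ℝ) :
    ∑ t, fsad d T x y w a b α t =
      (numNeg T y / T : ℝ) * ∑ t, ⟪w, x t⟫ ^ 2 * (if y t = 1 then (1 : ℝ) else 0)
        + (numPos T y / T : ℝ) * ∑ t, ⟪w, x t⟫ ^ 2 * (if y t = -1 then (1 : ℝ) else 0)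
        + (numPos T y * numNeg T y / T : ℝ) *
          (a ^ 2 - 2 * a * ⟪w, meanPos d T x y⟫ + (b ^ 2 - 2 * b * ⟪w, meanNeg d T x y⟫)
            - α ^ 2 + 2 * (1 + α) * (⟪w, meanNeg d T x y⟫ - ⟪w, meanPos d T x y⟫)) := by
  have hT0 : (T : ℝ) ≠ 0 := by positivity
  have hsum : (numPos T y : ℝ) + numNeg T y = T := mod_cast numPos_add_numNeg T y hy
  have hq : 1 - (numPos T y / T : ℝ) = numNeg T y / T := by
    field_simp
    linarith
  have hp1 : ∑ t, (if y t = 1 then (1 : ℝ) else 0) = numPos T y := by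
    simp [numPos]
  have hn1 : ∑ t, (if y t = -1 then (1 : ℝ) else 0) = numNeg T y := by
    simp [numNeg]
  have hc : ∑ _t : Fin T, (1 : ℝ) = T := by simp
  have hp := sum_inner_pos_eq d T x y hTp w
  have hn := sum_inner_neg_eq d T x y hTn w
  simp only [fsad, hq]
  set p : ℝ := numPos T y / T with hpdef
  set q : ℝ := numNeg T y / T with hqdef
  have hexpand : ∀ t, q * (⟪w, x t⟫ - a) ^ 2 * (if y t = 1 then (1 : ℝ) else 0)
      + p * (⟪w, x t⟫ - b) ^ 2 * (if y t = -1 then (1 : ℝ) else 0) - p * q * α ^ 2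
      + 2 * (1 + α) * ⟪w, x t⟫ *
        (p * (if y t = -1 then (1 : ℝ) else 0) - q * (if y t = 1 then (1 : ℝ) else 0)) =
      q * (⟪w, x t⟫ ^ 2 * (if y t = 1 then (1 : ℝ) else 0))
        + p * (⟪w, x t⟫ ^ 2 * (if y t = -1 then (1 : ℝ) else 0))
        + (-(2 * q * (a + 1 + α))) * (⟪w, x t⟫ * (if y t = 1 then (1 : ℝ) else 0))
        + (2 * p * (1 + α - b)) * (⟪w, x t⟫ * (if y t = -1 then (1 : ℝ) else 0))
        + q * a ^ 2 * (if y t = 1 then (1 : ℝ) else 0)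
        + p * b ^ 2 * (if y t = -1 then (1 : ℝ) else 0)
        + (-(p * q * α ^ 2)) * 1 := fun t => by ring
  simp only [hexpand, Finset.sum_add_distrib, ← Finset.mul_sum]
  rw [hp, hn, hp1, hn1, hc, hpdef, hqdef]
  field_simp
  ring

/-- `(a*, b*, α*) = (⟨w, x̄⁺⟩, ⟨w, x̄⁻⟩, b* - a*)` is a saddle point of
`(a, b, α) ↦ Σ_t f_t(w, a, b, α)`. -/
theorem saddle_point_of_sum_fsad (d T : ℕ) (hd : 1 ≤ d) (hT : 1 ≤ T)
    (x : Fin T → EuclideanSpace ℝ (Fin d)) (y : Fin T → ℤ)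
    (hy : ∀ t, y t = 1 ∨ y t = -1)
    (hTp : 1 ≤ numPos T y) (hTn : 1 ≤ numNeg T y)
    (w : EuclideanSpace ℝ (Fin d)) :
    (∀ α : ℝ,
        ∑ t, fsad d T x y w ⟪w, meanPos d T x y⟫ ⟪w, meanNeg d T x y⟫ α t
          ≤ ∑ t, fsad d T x y w ⟪w, meanPos d T x y⟫ ⟪w, meanNeg d T x y⟫
              (⟪w, meanNeg d T x y⟫ - ⟪w, meanPos d T x y⟫) t)
      ∧ ∀ a b : ℝ,
          ∑ t, fsad d T x y w ⟪w, meanPos d T x y⟫ ⟪w, meanNeg d T x y⟫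
              (⟪w, meanNeg d T x y⟫ - ⟪w, meanPos d T x y⟫) t
            ≤ ∑ t, fsad d T x y w a b
                (⟪w, meanNeg d T x y⟫ - ⟪w, meanPos d T x y⟫) t := by
  have hc : (0 : ℝ) ≤ numPos T y * numNeg T y / T := by positivity
  simp only [sum_fsad_eq d T hT x y hy hTp hTn w]
  set A := ⟪w, meanPos d T x y⟫
  set B := ⟪w, meanNeg d T x y⟫
  refine ⟨fun α => ?_, fun a b => ?_⟩
  · gcongr _ + _ * ?_
    linarith [sq_nonneg (α - (B - A))]
  · gcongr _ + _ * ?_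
    linarith [sq_nonneg (a - A), sq_nonneg (b - B)]
end
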